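/- arXiv:2206.07667 — 6 statements merged into one kernel-verified Lean document; each statement's English description precedes it below -/
import Mathlib

section
/- The boundary value problem ε²y'' = f(x,y) on (0,1), y(0) = y(1) = 0, has a unique solution y ∈ C²([0,1]). -/
open Set Filter Topology

/-- Weak maximum principle on `[0,1]`. -/
lemma le_of_deriv_deriv_pos_of_lt {w : ℝ → ℝ} {K : ℝ} (hw : ContinuousOn w (Icc 0 1))
    (h0 : w 0 ≤ K) (h1 : w 1 ≤ K)
    (hpos : ∀ x ∈ Ioo (0:ℝ) 1, K < w x → 0 < deriv (deriv w) x) :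
    ∀ x ∈ Icc (0:ℝ) 1, w x ≤ K := by
  obtain ⟨z, hz, hmax⟩ := isCompact_Icc.exists_isMaxOn (nonempty_Icc.2 zero_le_one) hw
  suffices hzK : w z ≤ K from fun x hx => (hmax hx).trans hzK
  by_contra! hlt
  have hz' : z ∈ Ioo (0:ℝ) 1 := by
    refine ⟨lt_of_le_of_ne hz.1 ?_, lt_of_le_of_ne hz.2 ?_⟩ <;> rintro rfl <;> linarith
  have hnhds : Icc (0:ℝ) 1 ∈ 𝓝 z := Icc_mem_nhds hz'.1 hz'.2
  have hlmax : IsLocalMax w z := hmax.isLocalMax hnhds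
  have hlmin : IsLocalMin w z :=
    isLocalMin_of_deriv_deriv_pos (hpos z hz' hlt) hlmax.deriv_eq_zero (hw.continuousAt hnhds)
  have hconst : w =ᶠ[𝓝 z] fun _ => w z := by
    filter_upwards [hlmax, hlmin] with x hx hx' using le_antisymm hx hx'
  have := hpos z hz' hlt
  rw [hconst.deriv.deriv_eq] at this
  simp at this

/-- Solution of the linear Dirichlet problem `w'' = μ² w + h`. -/
lemma exists_linear_dirichlet {μ : ℝ} (hμ : 0 < μ) {h : ℝ → ℝ} (hh : Continuous h) :
    ∃ w w' : ℝ → ℝ, (∀ x, HasDerivAt w (w' x) x) ∧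
      (∀ x, HasDerivAt w' (μ ^ 2 * w x + h x) x) ∧ w 0 = 0 ∧ w 1 = 0 := by
  let A : ℝ → ℝ := fun x => ∫ t in (0:ℝ)..x, Real.cosh (μ * t) * h t
  let B : ℝ → ℝ := fun x => ∫ t in (0:ℝ)..x, Real.sinh (μ * t) * h t
  have hA : ∀ x, HasDerivAt A (Real.cosh (μ * x) * h x) x := fun x =>
    ((by fun_prop : Continuous fun t => Real.cosh (μ * t) * h t).integral_hasStrictDerivAt
      0 x).hasDerivAt
  have hB : ∀ x, HasDerivAt B (Real.sinh (μ * x) * h x) x := fun x =>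
    ((by fun_prop : Continuous fun t => Real.sinh (μ * t) * h t).integral_hasStrictDerivAt
      0 x).hasDerivAt
  have hlin : ∀ x, HasDerivAt (fun x => μ * x) μ x := fun x => by
    simpa using (hasDerivAt_id x).const_mul μ
  have hs : ∀ x, HasDerivAt (fun x => Real.sinh (μ * x)) (Real.cosh (μ * x) * μ) x :=
    fun x => (hlin x).sinh
  have hc : ∀ x, HasDerivAt (fun x => Real.cosh (μ * x)) (Real.sinh (μ * x) * μ) x :=
    fun x => (hlin x).cosh
  have hs1 : Real.sinh μ ≠ 0 := (Real.sinh_pos_iff.2 hμ).ne'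
  let c : ℝ := (Real.sinh μ * A 1 - Real.cosh μ * B 1) / μ / Real.sinh μ
  refine ⟨fun x => (Real.sinh (μ * x) * A x - Real.cosh (μ * x) * B x) / μ
      - c * Real.sinh (μ * x),
    fun x => Real.cosh (μ * x) * A x - Real.sinh (μ * x) * B x - c * μ * Real.cosh (μ * x),
    fun x => ?_, fun x => ?_, ?_, ?_⟩
  · refine ((((hs x).mul (hA x)).sub ((hc x).mul (hB x))).div_const μ |>.sub
      ((hs x).const_mul c)).congr_deriv ?_
    field_simp
    ring
  · refine ((((hc x).mul (hA x)).sub ((hs x).mul (hB x))).sub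
      ((hc x).const_mul (c * μ))).congr_deriv ?_
    field_simp
    linear_combination h x * Real.cosh_sq_sub_sinh_sq (μ * x)
  · simp [A, B]
  · simp only [mul_one, c]
    field_simp
    ring

/-- Dirichlet problem for a monotone right-hand side with slopes between `m > 0` and `L`. -/
lemma exists_dirichlet_of_slope_bounds {g : ℝ → ℝ → ℝ} {m L : ℝ} (hm : 0 < m)
    (hg : Continuous (Function.uncurry g))
    (hlow : ∀ x u v, u ≤ v → m * (v - u) ≤ g x v - g x u)
    (hupp : ∀ x u v, u ≤ v → g x v - g x u ≤ L * (v - u)) :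
    ∃ y : ℝ → ℝ, ContDiff ℝ 2 y ∧ y 0 = 0 ∧ y 1 = 0 ∧
      ∀ x ∈ Icc (0:ℝ) 1, deriv (deriv y) x = g x (y x) := by
  have hmL : m ≤ L := by
    have h1 := hlow 0 0 1 zero_le_one
    have h2 := hupp 0 0 1 zero_le_one
    linarith
  have hL : 0 < L := hm.trans_le hmL
  let H : C(Icc (0:ℝ) 1, ℝ) → ℝ → ℝ := fun Y x =>
    g x (IccExtend zero_le_one Y x) - L * IccExtend zero_le_one Y x
  have hH : ∀ Y, Continuous (H Y) := fun Y => by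
    have hY : Continuous (IccExtend (zero_le_one' ℝ) Y) := Y.continuous.Icc_extend'
    exact (hg.comp (continuous_id.prodMk hY)).sub (continuous_const.mul hY)
  choose w w' hw hw' hw0 hw1 using fun Y => exists_linear_dirichlet (Real.sqrt_pos.2 hL) (hH Y)
  simp only [Real.sq_sqrt hL.le] at hw'
  have hwc : ∀ Y, Continuous (w Y) := fun Y =>
    continuous_iff_continuousAt.2 fun x => (hw Y x).continuousAt
  let T : C(Icc (0:ℝ) 1, ℝ) → C(Icc (0:ℝ) 1, ℝ) := fun Y =>
    ⟨fun x => w Y x, (hwc Y).comp continuous_subtype_val⟩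
  have hHd : ∀ Y Z x, |H Y x - H Z x| ≤ (L - m) * dist Y Z := fun Y Z x => by
    have hd : |IccExtend zero_le_one Y x - IccExtend zero_le_one Z x| ≤ dist Y Z :=
      ContinuousMap.dist_apply_le_dist (f := Y) (g := Z) _
    refine le_trans ?_ (mul_le_mul_of_nonneg_left hd (sub_nonneg.2 hmL))
    simp only [H]
    generalize IccExtend zero_le_one Y x = u
    generalize IccExtend zero_le_one Z x = v
    rcases le_total u v with huv | huv
    · have h1 := hlow x u v huv
      have h2 := hupp x u v huv
      rw [abs_of_nonpos (sub_nonpos.2 huv), abs_le]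
      constructor <;> linarith
    · have h1 := hlow x v u huv
      have h2 := hupp x v u huv
      rw [abs_of_nonneg (sub_nonneg.2 huv), abs_le]
      constructor <;> linarith
  have hle : ∀ Y Z, ∀ x ∈ Icc (0:ℝ) 1, w Y x - w Z x ≤ (1 - m / L) * dist Y Z := by
    intro Y Z
    have hdd : deriv (deriv fun x => w Y x - w Z x) =
        fun x => (L * w Y x + H Y x) - (L * w Z x + H Z x) := by
      have : (deriv fun x => w Y x - w Z x) = fun x => w' Y x - w' Z x :=
        funext fun x => ((hw Y x).sub (hw Z x)).deriv
      rw [this]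
      exact funext fun x => ((hw' Y x).sub (hw' Z x)).deriv
    have hK : 0 ≤ (1 - m / L) * dist Y Z :=
      mul_nonneg (sub_nonneg.2 ((div_le_one hL).2 hmL)) dist_nonneg
    refine le_of_deriv_deriv_pos_of_lt ((hwc Y).sub (hwc Z)).continuousOn
      (by simpa [hw0] using hK) (by simpa [hw1] using hK) fun x _ hlt => ?_
    rw [hdd]
    have h1 := (abs_le.1 (hHd Y Z x)).1
    have h2 := mul_lt_mul_of_pos_left hlt hL
    have h3 : L * ((1 - m / L) * dist Y Z) = (L - m) * dist Y Z := by field_simp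
    linarith
  have hT : ContractingWith (1 - m / L).toNNReal T := by
    constructor
    · rw [← NNReal.coe_lt_coe, Real.coe_toNNReal _ (sub_nonneg.2 ((div_le_one hL).2 hmL))]
      have := div_pos hm hL
      simpa using this
    · refine LipschitzWith.of_dist_le_mul fun Y Z => ?_
      rw [Real.coe_toNNReal _ (sub_nonneg.2 ((div_le_one hL).2 hmL)),
        ContinuousMap.dist_le
          (mul_nonneg (sub_nonneg.2 ((div_le_one hL).2 hmL)) dist_nonneg)]
      intro x
      have h1 := hle Y Z x x.2
      have h2 := hle Z Y x x.2
      rw [dist_comm Z Y] at h2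
      exact abs_le.2 ⟨by simp only [T, ContinuousMap.coe_mk]; linarith, h1⟩
  obtain ⟨Y, hY⟩ : ∃ Y, T Y = Y := ⟨_, hT.fixedPoint_isFixedPt⟩
  have hd1 : deriv (w Y) = w' Y := funext fun x => (hw Y x).deriv
  have hd2 : deriv (w' Y) = fun x => L * w Y x + H Y x := funext fun x => (hw' Y x).deriv
  refine ⟨w Y, ?_, hw0 Y, hw1 Y, fun x hx => ?_⟩
  · rw [show (2 : WithTop ℕ∞) = 1 + 1 by norm_num, contDiff_succ_iff_deriv]
    refine ⟨fun x => (hw Y x).differentiableAt, by simp, ?_⟩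
    rw [hd1, contDiff_one_iff_deriv, hd2]
    exact ⟨fun x => (hw' Y x).differentiableAt, (continuous_const.mul (hwc Y)).add (hH Y)⟩
  · have hYx : IccExtend zero_le_one Y x = w Y x := by
      rw [IccExtend_of_mem _ _ hx]
      exact (DFunLike.congr_fun hY ⟨x, hx⟩).symm
    rw [hd1, hd2]
    simp only [H, hYx]
    ring

lemma iteratedDerivWithin_two_Icc_eq {y : ℝ → ℝ} (hy : ContDiffOn ℝ 2 y (Icc 0 1)) {x : ℝ}
    (hx : x ∈ Ioo (0:ℝ) 1) :
    iteratedDerivWithin 2 y (Icc 0 1) x = deriv (deriv y) x := by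
  have h : ContDiffAt ℝ (2 : ℕ) y x := hy.contDiffAt (Icc_mem_nhds hx.1 hx.2)
  rw [iteratedDerivWithin_eq_iteratedDeriv (uniqueDiffOn_Icc zero_lt_one) h
    (Ioo_subset_Icc_self hx), iteratedDeriv_succ, iteratedDeriv_one]

lemma deriv_deriv_sub {y z : ℝ → ℝ} {x : ℝ} (hy : ContDiffAt ℝ 2 y x) (hz : ContDiffAt ℝ 2 z x) :
    deriv (deriv fun t => y t - z t) x = deriv (deriv y) x - deriv (deriv z) x := by
  have h := iteratedDeriv_fun_sub (n := 2) hy hz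
  simpa only [iteratedDeriv_succ, iteratedDeriv_zero] using h

/-- A solution lies below any other solution of the same strictly monotone Dirichlet problem. -/
lemma le_of_deriv_deriv_eq {g : ℝ → ℝ → ℝ} {y z : ℝ → ℝ}
    (hg : ∀ x ∈ Ioo (0:ℝ) 1, StrictMono (g x))
    (hy : ContDiffOn ℝ 2 y (Icc 0 1)) (hz : ContDiffOn ℝ 2 z (Icc 0 1))
    (h0 : y 0 = z 0) (h1 : y 1 = z 1)
    (hyg : ∀ x ∈ Ioo (0:ℝ) 1, deriv (deriv y) x = g x (y x))
    (hzg : ∀ x ∈ Ioo (0:ℝ) 1, deriv (deriv z) x = g x (z x)) :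
    ∀ x ∈ Icc (0:ℝ) 1, y x ≤ z x := by
  intro x hx
  refine sub_nonpos.1 (le_of_deriv_deriv_pos_of_lt (w := fun t => y t - z t)
    (hy.continuousOn.sub hz.continuousOn) (by simp [h0]) (by simp [h1]) (fun t ht hlt => ?_) x hx)
  have hn := Icc_mem_nhds ht.1 ht.2
  rw [deriv_deriv_sub (hy.contDiffAt hn) (hz.contDiffAt hn), hyg t ht, hzg t ht]
  exact sub_pos.2 (hg t ht (sub_pos.1 hlt))

/-- A monotone right-hand side, locally Lipschitz in `u`, can be truncated to one with bounded
slopes; the solution of the truncated problem stays where the truncation is inactive. -/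
lemma exists_dirichlet_of_slope_lower_bound {f : ℝ → ℝ → ℝ} {m : ℝ} (hm : 0 < m)
    (hf : ContDiffOn ℝ 1 (Function.uncurry f) (Icc 0 1 ×ˢ univ))
    (hlow : ∀ x ∈ Icc (0:ℝ) 1, ∀ u v, u ≤ v → m * (v - u) ≤ f x v - f x u) :
    ∃ y : ℝ → ℝ, ContDiff ℝ 2 y ∧ y 0 = 0 ∧ y 1 = 0 ∧
      ∀ x ∈ Icc (0:ℝ) 1, deriv (deriv y) x = f x (y x) := by
  obtain ⟨C, hC⟩ : ∃ C, ∀ x ∈ Icc (0:ℝ) 1, ‖f x 0‖ ≤ C := by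
    refine isCompact_Icc.exists_bound_of_continuousOn ?_
    exact hf.continuousOn.comp (f := fun x : ℝ => (x, (0:ℝ))) (by fun_prop)
      fun x hx => ⟨hx, mem_univ _⟩
  have hC0 : 0 ≤ C := (norm_nonneg _).trans (hC 0 (left_mem_Icc.2 zero_le_one))
  have hM : 0 ≤ C / m := by positivity
  set M := C / m with hMdef
  have hMm : m * M = C := by rw [hMdef]; field_simp
  have hMM : -M ≤ M := by linarith
  obtain ⟨K, hK⟩ := (hf.mono (prod_mono_right (subset_univ (Icc (-M) M)))).exists_lipschitzOnWith
    one_ne_zero ((convex_Icc 0 1).prod (convex_Icc _ _)) (isCompact_Icc.prod isCompact_Icc)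
  let p : ℝ → ℝ := fun x => projIcc 0 1 zero_le_one x
  let c : ℝ → ℝ := fun u => projIcc (-M) M hMM u
  have hp : ∀ x, p x ∈ Icc (0:ℝ) 1 := fun x => (projIcc 0 1 zero_le_one x).2
  have hc : ∀ u, c u ∈ Icc (-M) M := fun u => (projIcc (-M) M hMM u).2
  have hpx : ∀ x ∈ Icc (0:ℝ) 1, p x = x := fun x hx =>
    congrArg Subtype.val (projIcc_of_mem zero_le_one hx)
  have hcu : ∀ u ∈ Icc (-M) M, c u = u := fun u hu => congrArg Subtype.val (projIcc_of_mem hMM hu)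
  have hpc : Continuous p := continuous_subtype_val.comp continuous_projIcc
  have hcc : Continuous c := continuous_subtype_val.comp continuous_projIcc
  have hcmono : Monotone c := fun u v huv => monotone_projIcc hMM huv
  have hcle : ∀ u v, u ≤ v → c v - c u ≤ v - u := fun u v huv => by
    simp only [c, coe_projIcc]
    grind
  let g : ℝ → ℝ → ℝ := fun x u => f (p x) (c u) + m * (u - c u)
  have hgc : Continuous (Function.uncurry g) := by
    have h : Continuous fun q : ℝ × ℝ => f (p q.1) (c q.2) :=
      hf.continuousOn.comp_continuous (f := fun q : ℝ × ℝ => (p q.1, c q.2)) (by fun_prop)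
        fun q => ⟨hp _, mem_univ _⟩
    exact h.add (by fun_prop)
  have hglow : ∀ x u v, u ≤ v → m * (v - u) ≤ g x v - g x u := fun x u v huv => by
    have := hlow (p x) (hp x) _ _ (hcmono huv)
    simp only [g]
    linarith
  have hgupp : ∀ x u v, u ≤ v → g x v - g x u ≤ (K + m) * (v - u) := fun x u v huv => by
    have h1 := hK.dist_le_mul (p x, c v) ⟨hp x, hc v⟩ (p x, c u) ⟨hp x, hc u⟩
    have h2 := hcmono huv
    have h3 := mul_le_mul_of_nonneg_left (hcle u v huv) K.2
    have h4 := mul_nonneg hm.le (sub_nonneg.2 h2)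
    rw [Prod.dist_eq, dist_self, max_eq_right dist_nonneg, Real.dist_eq, Real.dist_eq,
      abs_of_nonneg (sub_nonneg.2 h2)] at h1
    have h5 := (le_abs_self _).trans h1
    simp only [Function.uncurry_apply_pair] at h5
    simp only [NNReal.val_eq_coe] at h3
    simp only [g]
    linarith
  obtain ⟨y, hy, hy0, hy1, hyg⟩ := exists_dirichlet_of_slope_bounds hm hgc hglow hgupp
  have hg0 : ∀ x ∈ Icc (0:ℝ) 1, |g x 0| ≤ C := fun x hx => by
    simpa [g, hpx x hx, hcu 0 ⟨by linarith, hM⟩] using hC x hx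
  have hyle : ∀ x ∈ Icc (0:ℝ) 1, y x ≤ M := by
    refine le_of_deriv_deriv_pos_of_lt hy.continuous.continuousOn (by rwa [hy0]) (by rwa [hy1])
      fun x hx hlt => ?_
    have hx' := Ioo_subset_Icc_self hx
    rw [hyg x hx']
    have h1 := hglow x 0 (y x) (hM.trans hlt.le)
    have h2 := (abs_le.1 (hg0 x hx')).1
    have h3 := mul_lt_mul_of_pos_left hlt hm
    linarith
  have hley : ∀ x ∈ Icc (0:ℝ) 1, -y x ≤ M := by
    refine le_of_deriv_deriv_pos_of_lt (w := fun x => -y x) hy.continuous.neg.continuousOn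
      (by simpa [hy0]) (by simpa [hy1]) fun x hx hlt => ?_
    have hx' := Ioo_subset_Icc_self hx
    rw [deriv.fun_neg', deriv.fun_neg, hyg x hx']
    have h1 := hglow x (y x) 0 (by linarith)
    have h2 := (abs_le.1 (hg0 x hx')).2
    have h3 := mul_lt_mul_of_pos_left hlt hm
    linarith
  refine ⟨y, hy, hy0, hy1, fun x hx => ?_⟩
  rw [hyg x hx]
  simp only [g]
  rw [hpx x hx, hcu (y x) ⟨by linarith [hley x hx], hyle x hx⟩]
  ring


/-- The boundary value problem `ε²y'' = f(x,y)` on `(0,1)`, `y(0) = y(1) = 0`,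
where `0 < ε < 1`, `f ∈ C^k([0,1]×ℝ)` with `k ≥ 2` and `∂f/∂y ≥ m > 0`,
has a unique solution `y ∈ C²([0,1])` (uniqueness as functions on `[0,1]`). -/
theorem bvp_exists_unique
    (ε m : ℝ) (k : ℕ) (f : ℝ → ℝ → ℝ)
    (hε : 0 < ε) (hε1 : ε < 1) (hk : 2 ≤ k) (hm : 0 < m)
    (hf : ContDiffOn ℝ k (Function.uncurry f) (Set.Icc 0 1 ×ˢ Set.univ))
    (hfy : ∀ x ∈ Set.Icc (0:ℝ) 1, ∀ u : ℝ, m ≤ deriv (f x) u) :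
    (∃ y : ℝ → ℝ, ContDiffOn ℝ 2 y (Set.Icc 0 1) ∧ y 0 = 0 ∧ y 1 = 0 ∧
      ∀ x ∈ Set.Ioo (0:ℝ) 1,
        ε ^ 2 * iteratedDerivWithin 2 y (Set.Icc 0 1) x = f x (y x)) ∧
    (∀ y₁ y₂ : ℝ → ℝ,
      (ContDiffOn ℝ 2 y₁ (Set.Icc 0 1) ∧ y₁ 0 = 0 ∧ y₁ 1 = 0 ∧
        ∀ x ∈ Set.Ioo (0:ℝ) 1,
          ε ^ 2 * iteratedDerivWithin 2 y₁ (Set.Icc 0 1) x = f x (y₁ x)) →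
      (ContDiffOn ℝ 2 y₂ (Set.Icc 0 1) ∧ y₂ 0 = 0 ∧ y₂ 1 = 0 ∧
        ∀ x ∈ Set.Ioo (0:ℝ) 1,
          ε ^ 2 * iteratedDerivWithin 2 y₂ (Set.Icc 0 1) x = f x (y₂ x)) →
      Set.EqOn y₁ y₂ (Set.Icc 0 1)) := by
  have hε2 : 0 < ε ^ 2 := by positivity
  have hlow : ∀ x ∈ Icc (0:ℝ) 1, ∀ u v, u ≤ v → m * (v - u) ≤ f x v - f x u :=
    fun x hx u v huv => mul_sub_le_image_sub_of_le_deriv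
      (fun u => differentiableAt_of_deriv_ne_zero (hm.trans_le (hfy x hx u)).ne') (hfy x hx) huv
  have hsolves : ∀ y : ℝ → ℝ, ContDiffOn ℝ 2 y (Icc 0 1) → ∀ x ∈ Ioo (0:ℝ) 1,
      (ε ^ 2 * iteratedDerivWithin 2 y (Icc 0 1) x = f x (y x) ↔
        deriv (deriv y) x = f x (y x) / ε ^ 2) := fun y hy x hx => by
    rw [iteratedDerivWithin_two_Icc_eq hy hx, eq_div_iff hε2.ne', mul_comm]
  refine ⟨?_, ?_⟩
  · obtain ⟨y, hy, hy0, hy1, hyf⟩ := exists_dirichlet_of_slope_lower_bound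
      (f := fun x u => f x u / ε ^ 2) (div_pos hm hε2)
      ((hf.of_le (by exact_mod_cast one_le_two.trans hk)).div_const (ε ^ 2))
      fun x hx u v huv => by
        rw [div_mul_eq_mul_div, ← sub_div]
        exact div_le_div_of_nonneg_right (hlow x hx u v huv) hε2.le
    exact ⟨y, hy.contDiffOn, hy0, hy1, fun x hx =>
      (hsolves y hy.contDiffOn x hx).2 (hyf x (Ioo_subset_Icc_self hx))⟩
  · rintro y z ⟨hy, hy0, hy1, hyf⟩ ⟨hz, hz0, hz1, hzf⟩ x hx
    have hmono : ∀ x ∈ Ioo (0:ℝ) 1, StrictMono fun u => f x u / ε ^ 2 := fun x hx u v huv => by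
      have h1 := hlow x (Ioo_subset_Icc_self hx) u v huv.le
      have h2 := mul_pos hm (sub_pos.2 huv)
      exact div_lt_div_of_pos_right (by linarith) hε2
    have hyd := fun x hx => (hsolves y hy x hx).1 (hyf x hx)
    have hzd := fun x hx => (hsolves z hz x hx).1 (hzf x hx)
    exact le_antisymm
      (le_of_deriv_deriv_eq hmono hy hz (hy0.trans hz0.symm) (hy1.trans hz1.symm) hyd hzd x hx)
      (le_of_deriv_deriv_eq hmono hz hy (hz0.trans hy0.symm) (hz1.trans hy1.symm) hzd hyd x hx)
end

section
/- There exists a constant C > 0, independent of N and of λ ∈ (0,1/4], such that the modified Shishkin mesh x_i = ψ(i/N), i = 0,…,N, with step sizes h_i = x_{i+1} − x_i, satisfies h_i ≤ C N^{−1} for all i = 0,…,N−1 and |h_{i+1} − h_i| ≤ C N^{−2} for all i = 0,…,N−2. -/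
/-- The modified Shishkin (Vulanović) mesh-generating function:
`ψ(t) = 4λt` on `[0,1/4]`, `ψ(t) = p(t-1/4)³ + 4λt` on `[1/4,1/2]` with
`p = 32(1-4λ)`, and `ψ(t) = 1 - ψ(1-t)` on `[1/2,1]`. -/
noncomputable def shishkinPsi (lam t : ℝ) : ℝ :=
  if t ≤ 1 / 2 then
    (if t ≤ 1 / 4 then 4 * lam * t
     else 32 * (1 - 4 * lam) * (t - 1 / 4) ^ 3 + 4 * lam * t)
  else
    1 - (if 1 - t ≤ 1 / 4 then 4 * lam * (1 - t)
         else 32 * (1 - 4 * lam) * ((1 - t) - 1 / 4) ^ 3 + 4 * lam * (1 - t))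

/-- The part of the mesh-generating function that does not depend on `λ`. -/
noncomputable def shishkinCubic (t : ℝ) : ℝ :=
  if t ≤ 1 / 4 then 0
  else if t ≤ 1 / 2 then 32 * (t - 1 / 4) ^ 3
  else if t ≤ 3 / 4 then 1 - 32 * (3 / 4 - t) ^ 3
  else 1

theorem shishkinPsi_eq (lam t : ℝ) :
    shishkinPsi lam t = 4 * lam * t + (1 - 4 * lam) * shishkinCubic t := by
  unfold shishkinPsi shishkinCubic
  split_ifs <;> first
    | (exfalso; linarith)
    | ring1
    | (obtain rfl : t = 3 / 4 := by linarith
       ring)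

theorem shishkinCubic_of_le {t : ℝ} (h : t ≤ 1 / 4) : shishkinCubic t = 0 := by
  simp only [shishkinCubic, if_pos h]

theorem shishkinCubic_of_mem_left {t : ℝ} (h₁ : 1 / 4 ≤ t) (h₂ : t ≤ 1 / 2) :
    shishkinCubic t = 32 * (t - 1 / 4) ^ 3 := by
  rcases h₁.eq_or_lt with rfl | h₁
  · norm_num [shishkinCubic]
  · simp only [shishkinCubic, if_neg h₁.not_ge, if_pos h₂]

theorem shishkinCubic_one_sub (t : ℝ) : shishkinCubic (1 - t) = 1 - shishkinCubic t := by
  unfold shishkinCubic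
  split_ifs <;> first
    | (exfalso; linarith)
    | ring1
    | (obtain rfl : t = 1 / 2
       linarith
       norm_num)
    | (obtain rfl : t = 3 / 4
       linarith
       norm_num)
    | (obtain rfl : t = 1 / 4
       linarith
       norm_num)

theorem shishkinCubic_of_mem_right {t : ℝ} (h₁ : 1 / 2 ≤ t) (h₂ : t ≤ 3 / 4) :
    shishkinCubic t = 1 - 32 * (3 / 4 - t) ^ 3 := by
  have h := shishkinCubic_one_sub t
  rw [shishkinCubic_of_mem_left (by linarith) (by linarith)] at h
  linear_combination h

theorem shishkinCubic_of_ge {t : ℝ} (h : 3 / 4 ≤ t) : shishkinCubic t = 1 := by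
  have h' := shishkinCubic_one_sub t
  rw [shishkinCubic_of_le (by linarith)] at h'
  linarith

theorem cube_sub_cube_le {a b : ℝ} (ha : 0 ≤ a) (hab : a ≤ b) (hb : b ≤ 1 / 4) :
    32 * b ^ 3 - 32 * a ^ 3 ≤ 6 * (b - a) := by
  have h : b ^ 2 + a * b + a ^ 2 ≤ 3 / 16 := by nlinarith
  nlinarith [mul_le_mul_of_nonneg_left h (sub_nonneg.2 hab)]

/-- Increments of the cubic part over an interval not crossing a breakpoint. -/
theorem shishkinCubic_sub_le {s t : ℝ} (hst : s ≤ t)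
    (h : t ≤ 1 / 4 ∨ (1 / 4 ≤ s ∧ t ≤ 1 / 2) ∨ (1 / 2 ≤ s ∧ t ≤ 3 / 4) ∨ 3 / 4 ≤ s) :
    shishkinCubic t - shishkinCubic s ≤ 6 * (t - s) := by
  rcases h with h | ⟨h₁, h₂⟩ | ⟨h₁, h₂⟩ | h
  · rw [shishkinCubic_of_le h, shishkinCubic_of_le (hst.trans h)]
    linarith
  · rw [shishkinCubic_of_mem_left h₁ (hst.trans h₂), shishkinCubic_of_mem_left (h₁.trans hst) h₂]
    linarith [cube_sub_cube_le (sub_nonneg.2 h₁) (sub_le_sub_right hst (1 / 4)) (by linarith)]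
  · rw [shishkinCubic_of_mem_right h₁ (hst.trans h₂), shishkinCubic_of_mem_right (h₁.trans hst) h₂]
    linarith [cube_sub_cube_le (sub_nonneg.2 h₂) (sub_le_sub_left hst (3 / 4)) (by linarith)]
  · rw [shishkinCubic_of_ge h, shishkinCubic_of_ge (h.trans hst)]
    linarith

/-- Second differences of the cubic part, where breakpoints may occur only at the centre
or the end points. -/
theorem abs_shishkinCubic_second_diff_le {c d : ℝ} (hd : 0 ≤ d) (hd' : d ≤ 1 / 4)
    (h : c + d ≤ 1 / 4 ∨ c = 1 / 4 ∨ (1 / 4 ≤ c - d ∧ c + d ≤ 1 / 2) ∨ c = 1 / 2 ∨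
      (1 / 2 ≤ c - d ∧ c + d ≤ 3 / 4) ∨ c = 3 / 4 ∨ 3 / 4 ≤ c - d) :
    |shishkinCubic (c + d) - 2 * shishkinCubic c + shishkinCubic (c - d)| ≤ 48 * d ^ 2 := by
  have hd2 : 0 ≤ d ^ 2 := sq_nonneg d
  have hd3 : 0 ≤ d ^ 3 := by positivity
  have hd32 : d ^ 3 ≤ 1 / 4 * d ^ 2 := by nlinarith
  rcases h with h | rfl | ⟨h₁, h₂⟩ | rfl | ⟨h₁, h₂⟩ | rfl | h
  · rw [shishkinCubic_of_le h, shishkinCubic_of_le (by linarith), shishkinCubic_of_le (by linarith)]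
    norm_num
    exact hd2
  · rw [shishkinCubic_of_mem_left (by linarith) (by linarith), shishkinCubic_of_le le_rfl,
      shishkinCubic_of_le (by linarith), abs_le]
    constructor <;> nlinarith
  · rw [shishkinCubic_of_mem_left (by linarith) h₂,
      shishkinCubic_of_mem_left (by linarith) (by linarith),
      shishkinCubic_of_mem_left h₁ (by linarith), abs_le]
    have hc : 0 ≤ c - 1 / 4 := by linarith
    have hc' : 0 ≤ 1 / 2 - c := by linarith
    constructor <;> nlinarith [mul_nonneg hc hd2, mul_nonneg hc' hd2]
  · rw [shishkinCubic_of_mem_right (by linarith) (by linarith),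
      shishkinCubic_of_mem_left (by norm_num) le_rfl,
      shishkinCubic_of_mem_left (by linarith) (by linarith), abs_le]
    constructor <;> nlinarith
  · rw [shishkinCubic_of_mem_right (by linarith) h₂,
      shishkinCubic_of_mem_right (by linarith) (by linarith),
      shishkinCubic_of_mem_right h₁ (by linarith), abs_le]
    have hc : 0 ≤ c - 1 / 2 := by linarith
    have hc' : 0 ≤ 3 / 4 - c := by linarith
    constructor <;> nlinarith [mul_nonneg hc hd2, mul_nonneg hc' hd2]
  · rw [shishkinCubic_of_ge (by linarith), shishkinCubic_of_ge le_rfl,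
      shishkinCubic_of_mem_right (by linarith) (by linarith), abs_le]
    constructor <;> nlinarith
  · rw [shishkinCubic_of_ge (by linarith), shishkinCubic_of_ge (by linarith), shishkinCubic_of_ge h]
    norm_num
    exact hd2

/-- There is a constant `C > 0` independent of `N` and of `λ ∈ (0,1/4]` such that
the modified Shishkin mesh `x_i = ψ(i/N)` with steps `h_i = x_{i+1} - x_i` satisfies
`h_i ≤ C N⁻¹` for `i = 0,…,N-1` and `|h_{i+1} - h_i| ≤ C N⁻²` for `i = 0,…,N-2`. -/
theorem shishkinMesh_step_bounds :
    ∃ C > (0:ℝ), ∀ (N : ℕ) (lam : ℝ), 0 < N → 4 ∣ N → 0 < lam → lam ≤ 1 / 4 →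
      (∀ i : ℕ, i < N →
        shishkinPsi lam (((i : ℝ) + 1) / (N : ℝ)) - shishkinPsi lam ((i : ℝ) / (N : ℝ)) ≤ C / (N : ℝ)) ∧
      (∀ i : ℕ, i + 2 ≤ N →
        |(shishkinPsi lam (((i : ℝ) + 2) / (N : ℝ)) - shishkinPsi lam (((i : ℝ) + 1) / (N : ℝ))) -
         (shishkinPsi lam (((i : ℝ) + 1) / (N : ℝ)) - shishkinPsi lam ((i : ℝ) / (N : ℝ)))| ≤
          C / (N : ℝ) ^ 2) := by
  refine ⟨48, by norm_num, ?_⟩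
  rintro N lam hN ⟨m, rfl⟩ hlam hlam'
  have hm : 0 < m := by omega
  have hmR : (1 : ℝ) ≤ m := by exact_mod_cast hm
  have hNR : (0 : ℝ) < ((4 * m : ℕ) : ℝ) := by exact_mod_cast hN
  have hNm : ((4 * m : ℕ) : ℝ) = 4 * m := by push_cast; ring
  set n : ℝ := ((4 * m : ℕ) : ℝ)
  have hd : 0 < 1 / n := by positivity
  have hmu : 0 ≤ 1 - 4 * lam := by linarith
  refine ⟨fun i hi => ?_, fun i hi => ?_⟩
  · have hst : ((i : ℝ) + 1) / n - i / n = 1 / n := by ring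
    have key : shishkinCubic (((i : ℝ) + 1) / n) - shishkinCubic (i / n) ≤ 6 * (1 / n) := by
      rw [← hst]
      refine shishkinCubic_sub_le (by linarith) ?_
      simp only [div_le_iff₀ hNR, le_div_iff₀ hNR]
      have h : i + 1 ≤ m ∨ (m ≤ i ∧ i + 1 ≤ 2 * m) ∨ (2 * m ≤ i ∧ i + 1 ≤ 3 * m) ∨ 3 * m ≤ i := by
        omega
      rify at h
      have e₁ : 1 / 4 * n = m := by linarith
      have e₂ : 1 / 2 * n = 2 * m := by linarith
      have e₃ : 3 / 4 * n = 3 * m := by linarith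
      rwa [e₁, e₂, e₃]
    rw [shishkinPsi_eq, shishkinPsi_eq]
    have h48 : 48 / n = 48 * (1 / n) := by ring
    rw [h48]
    nlinarith [mul_le_mul_of_nonneg_left key hmu, mul_pos hlam hd]
  · have hc₁ : ((i : ℝ) + 2) / n = (i + 1) / n + 1 / n := by ring
    have hc₂ : (i : ℝ) / n = (i + 1) / n - 1 / n := by ring
    have key : |shishkinCubic (((i : ℝ) + 2) / n) - 2 * shishkinCubic ((i + 1) / n)
        + shishkinCubic (i / n)| ≤ 48 * (1 / n) ^ 2 := by
      rw [hc₁, hc₂]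
      refine abs_shishkinCubic_second_diff_le hd.le ?_ ?_
      · rw [div_le_iff₀ hNR]
        linarith
      · rw [← hc₁, ← hc₂]
        simp only [div_le_iff₀ hNR, le_div_iff₀ hNR, div_eq_iff hNR.ne']
        have h : i + 2 ≤ m ∨ i + 1 = m ∨ (m ≤ i ∧ i + 2 ≤ 2 * m) ∨ i + 1 = 2 * m ∨
            (2 * m ≤ i ∧ i + 2 ≤ 3 * m) ∨ i + 1 = 3 * m ∨ 3 * m ≤ i := by omega
        rify at h
        have e₁ : 1 / 4 * n = m := by linarith
        have e₂ : 1 / 2 * n = 2 * m := by linarith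
        have e₃ : 3 / 4 * n = 3 * m := by linarith
        rwa [e₁, e₂, e₃]
    simp only [shishkinPsi_eq]
    calc _ = |(1 - 4 * lam) * (shishkinCubic (((i : ℝ) + 2) / n)
          - 2 * shishkinCubic ((i + 1) / n) + shishkinCubic (i / n))| := by
          congr 1
          ring
      _ ≤ 1 * (48 * (1 / n) ^ 2) := by
          rw [abs_mul, abs_of_nonneg hmu]
          exact mul_le_mul (by linarith) key (abs_nonneg _) zero_le_one
      _ = 48 / n ^ 2 := by ring
end

section
/- Let 0 < ε < 1, q ∈ (0,1/2), a ∈ (0, q/ε), and let μ(t) = aεt/(q−t) for t ∈ [0,q). Set α = ( q − √( aqε(1 − 2q + 2aε) ) ) / (1 + 2aε). Then α ∈ (0, q) and the tangent line to μ at t = α passes through the point (1/2, 1/2); that is, μ(α) + μ'(α)(1/2 − α) = 1/2. -/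
/-- The derivative of the hyperbola `t ↦ c t / (q - t)` away from its pole. -/
lemma hasDerivAt_mul_div_sub {c q t : ℝ} (h : q - t ≠ 0) :
    HasDerivAt (fun t => c * t / (q - t)) (c * q / (q - t) ^ 2) t := by
  refine (((hasDerivAt_id' t).const_mul c).fun_div ((hasDerivAt_id' t).const_sub q) h).congr_deriv ?_
  ring

/-- In the modified Bakhvalov mesh of Vulanović, with `μ(t) = aεt/(q−t)` and
`α = (q − √(aqε(1−2q+2aε)))/(1+2aε)`, one has `α ∈ (0,q)` and the tangent line to
`μ` at `t = α` passes through the point `(1/2, 1/2)`. -/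
theorem bakhvalov_tangent_point
    (ε q a : ℝ) (hε : 0 < ε) (hε1 : ε < 1)
    (hq0 : 0 < q) (hq : q < 1 / 2) (ha0 : 0 < a) (ha : a < q / ε) :
    let μ : ℝ → ℝ := fun t => a * ε * t / (q - t)
    let α : ℝ := (q - Real.sqrt (a * q * ε * (1 - 2 * q + 2 * a * ε))) / (1 + 2 * a * ε)
    0 < α ∧ α < q ∧ μ α + deriv μ α * (1 / 2 - α) = 1 / 2 := by
  intro μ α
  have hc : 0 < a * ε := mul_pos ha0 hε
  have hcq : a * ε < q := (lt_div_iff₀ hε).mp ha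
  have hd : 0 < 1 + 2 * a * ε := by linarith
  have hr : 0 < 1 - 2 * q + 2 * a * ε := by linarith
  set s := Real.sqrt (a * q * ε * (1 - 2 * q + 2 * a * ε)) with hs
  have hs0 : 0 ≤ s := Real.sqrt_nonneg _
  have hs2 : s ^ 2 = a * q * ε * (1 - 2 * q + 2 * a * ε) := Real.sq_sqrt (by positivity)
  have hsq : s < q := by
    refine lt_of_pow_lt_pow_left₀ 2 hq0.le ?_
    have h : a * ε * (1 - 2 * q + 2 * a * ε) < q := by nlinarith
    nlinarith [mul_lt_mul_of_pos_left h hq0]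
  have hαs : α * (1 + 2 * a * ε) = q - s := div_mul_cancel₀ _ hd.ne'
  have hαq : α < q := by
    refine (div_lt_iff₀ hd).mpr ?_
    nlinarith [mul_pos hq0 hc]
  refine ⟨div_pos (by linarith) hd, hαq, ?_⟩
  have hne : q - α ≠ 0 := (sub_pos.mpr hαq).ne'
  have hquad : α ^ 2 * (1 + 2 * a * ε) - 2 * q * α + q ^ 2 - a * ε * q = 0 := by
    refine (mul_eq_zero.mp ?_).resolve_left hd.ne'
    linear_combination (α * (1 + 2 * a * ε) - q - s) * hαs + hs2
  have hderiv : deriv μ α = a * ε * q / (q - α) ^ 2 := (hasDerivAt_mul_div_sub hne).deriv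
  rw [hderiv]
  change a * ε * α / (q - α) + _ = _
  clear_value α
  field_simp
  linear_combination -hquad
end

section
/- Let γ > 0, 0 < ε < 1, β = √γ/ε, let x_{i−1} < x_i < x_{i+1} be real numbers with h_{i−1} = x_i − x_{i−1}, h_i = x_{i+1} − x_i, let g : [x_{i−1}, x_{i+1}] → ℝ be continuous, and let y ∈ C²([x_{i−1}, x_{i+1}]) satisfy ε² y''(x) = γ y(x) + g(x) on [x_{i−1}, x_{i+1}]. Then (β/sinh(βh_{i−1})) y(x_{i−1}) − ( β/tanh(βh_{i−1}) + β/tanh(βh_i) ) y(x_i) + (β/sinh(βh_i)) y(x_{i+1}) = (1/ε²) [ ∫_{x_{i−1}}^{x_i} ( sinh(β(s − x_{i−1})) / sinh(βh_{i−1}) ) g(s) ds + ∫_{x_i}^{x_{i+1}} ( sinh(β(x_{i+1} − s)) / sinh(βh_i) ) g(s) ds ]. -/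
/-- Integration of the Lagrange identity for `y'' - β²y` against the solution `sinh (β (s - c))` of
the homogeneous equation. -/
theorem integral_sinh_mul_of_deriv_deriv_eq {a b : ℝ} (hab : a ≤ b) (β c : ℝ) {y y' f : ℝ → ℝ}
    (hy : ∀ x ∈ Set.Icc a b, HasDerivWithinAt y (y' x) (Set.Icc a b) x)
    (hy' : ∀ x ∈ Set.Icc a b, HasDerivWithinAt y' (β ^ 2 * y x + f x) (Set.Icc a b) x)
    (hf : ContinuousOn f (Set.Icc a b)) :
    ∫ s in a..b, Real.sinh (β * (s - c)) * f s =
      (Real.sinh (β * (b - c)) * y' b - β * Real.cosh (β * (b - c)) * y b) -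
        (Real.sinh (β * (a - c)) * y' a - β * Real.cosh (β * (a - c)) * y a) := by
  have hF : ∀ x ∈ Set.Icc a b, HasDerivWithinAt
      (fun s => Real.sinh (β * (s - c)) * y' s - β * Real.cosh (β * (s - c)) * y s)
      (Real.sinh (β * (x - c)) * f x) (Set.Icc a b) x := by
    intro x hx
    have hlin : HasDerivAt (fun s => β * (s - c)) β x := by
      simpa using ((hasDerivAt_id x).sub_const c).const_mul β
    refine ((hlin.sinh.hasDerivWithinAt.mul (hy' x hx)).sub
      ((hlin.cosh.const_mul β).hasDerivWithinAt.mul (hy x hx))).congr_deriv ?_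
    ring
  refine intervalIntegral.integral_eq_sub_of_hasDerivAt_of_le hab
    (fun x hx => (hF x hx).continuousWithinAt)
    (fun x hx => (hF x (Set.Ioo_subset_Icc_self hx)).hasDerivAt (Icc_mem_nhds hx.1 hx.2)) ?_
  refine ContinuousOn.intervalIntegrable_of_Icc hab (ContinuousOn.mul ?_ hf)
  fun_prop


/-- Boglaev's exact three-point identity: if `ε²y'' = γy + g` on `[x_{i-1}, x_{i+1}]`
with `y ∈ C²` there and `g` continuous, then the hyperbolic three-point combination of
the nodal values of `y` equals the weighted integrals of `g` against the local
hyperbolic basis functions. Here `β = √γ/ε`, `h_{i-1} = x_i - x_{i-1}`, `h_i = x_{i+1} - x_i`. -/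
theorem boglaev_identity
    (γ ε : ℝ) (hγ : 0 < γ) (hε : 0 < ε) (hε1 : ε < 1)
    (β : ℝ) (hβ : β = Real.sqrt γ / ε)
    (xm xi xp : ℝ) (hx1 : xm < xi) (hx2 : xi < xp)
    (y y' y'' g : ℝ → ℝ)
    (hy' : ∀ x ∈ Set.Icc xm xp, HasDerivWithinAt y (y' x) (Set.Icc xm xp) x)
    (hy'' : ∀ x ∈ Set.Icc xm xp, HasDerivWithinAt y' (y'' x) (Set.Icc xm xp) x)
    (hy''c : ContinuousOn y'' (Set.Icc xm xp))
    (hg : ContinuousOn g (Set.Icc xm xp))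
    (hode : ∀ x ∈ Set.Icc xm xp, ε ^ 2 * y'' x = γ * y x + g x) :
    β / Real.sinh (β * (xi - xm)) * y xm -
      (β / Real.tanh (β * (xi - xm)) + β / Real.tanh (β * (xp - xi))) * y xi +
      β / Real.sinh (β * (xp - xi)) * y xp =
    (1 / ε ^ 2) *
      ((∫ s in xm..xi, Real.sinh (β * (s - xm)) / Real.sinh (β * (xi - xm)) * g s) +
       (∫ s in xi..xp, Real.sinh (β * (xp - s)) / Real.sinh (β * (xp - xi)) * g s)) := by
  have hβ0 : 0 < β := hβ ▸ div_pos (Real.sqrt_pos.2 hγ) hε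
  have hβ2 : β ^ 2 = γ / ε ^ 2 := by rw [hβ, div_pow, Real.sq_sqrt hγ.le]
  have hode' : ∀ x ∈ Set.Icc xm xp, y'' x = β ^ 2 * y x + g x / ε ^ 2 := by
    intro x hx
    have := hode x hx
    rw [hβ2]
    field_simp
    linarith
  have hl : Set.Icc xm xi ⊆ Set.Icc xm xp := Set.Icc_subset_Icc_right hx2.le
  have hr : Set.Icc xi xp ⊆ Set.Icc xm xp := Set.Icc_subset_Icc_left hx1.le
  have hL := integral_sinh_mul_of_deriv_deriv_eq hx1.le β xm
    (fun x hx => (hy' x (hl hx)).mono hl)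
    (fun x hx => hode' x (hl hx) ▸ (hy'' x (hl hx)).mono hl) ((hg.mono hl).div_const (ε ^ 2))
  have hR := integral_sinh_mul_of_deriv_deriv_eq hx2.le β xp
    (fun x hx => (hy' x (hr hx)).mono hr)
    (fun x hx => hode' x (hr hx) ▸ (hy'' x (hr hx)).mono hr) ((hg.mono hr).div_const (ε ^ 2))
  have hS₁ : 0 < Real.sinh (β * (xi - xm)) := Real.sinh_pos_iff.2 (mul_pos hβ0 (sub_pos.2 hx1))
  have hS₂ : 0 < Real.sinh (β * (xp - xi)) := Real.sinh_pos_iff.2 (mul_pos hβ0 (sub_pos.2 hx2))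
  have hneg : ∀ s, β * (s - xp) = -(β * (xp - s)) := fun s => by ring
  have hIL : ∫ s in xm..xi, Real.sinh (β * (s - xm)) / Real.sinh (β * (xi - xm)) * g s =
      ε ^ 2 / Real.sinh (β * (xi - xm)) *
        ∫ s in xm..xi, Real.sinh (β * (s - xm)) * (g s / ε ^ 2) := by
    rw [← intervalIntegral.integral_const_mul]
    congr 1 with s
    field_simp
  have hIR : ∫ s in xi..xp, Real.sinh (β * (xp - s)) / Real.sinh (β * (xp - xi)) * g s =
      -(ε ^ 2 / Real.sinh (β * (xp - xi))) *
        ∫ s in xi..xp, Real.sinh (β * (s - xp)) * (g s / ε ^ 2) := by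
    rw [← intervalIntegral.integral_const_mul]
    congr 1 with s
    rw [hneg, Real.sinh_neg]
    field_simp
  rw [hIL, hIR, hL, hR, hneg xi, Real.sinh_neg, Real.cosh_neg, Real.tanh_eq_sinh_div_cosh,
    Real.tanh_eq_sinh_div_cosh]
  simp only [sub_self, mul_zero, Real.sinh_zero, Real.cosh_zero]
  field_simp
  ring
end

section
/- For every u ∈ ℝ^{N+1}, the Jacobian matrix H = (h_{ij}) of T at u is strictly diagonally dominant in every interior row, with dominance at least 2m: |h_{i,i}| − |h_{i,i−1}| − |h_{i,i+1}| ≥ 2m > 0 for all interior rows i. -/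
/-- `A(h) = (cosh(βh) − 1)/sinh(βh)`. -/
noncomputable def Acoef (β h : ℝ) : ℝ := (Real.cosh (β * h) - 1) / Real.sinh (β * h)

/-- `B(h) = (cosh(βh) + 1)/sinh(βh)`. -/
noncomputable def Bcoef (β h : ℝ) : ℝ := (Real.cosh (β * h) + 1) / Real.sinh (β * h)

/-- Entry `(i,j)` of the Jacobian matrix `H` of the discrete operator `T` at the
point `u`, where `f'` denotes the partial derivative `∂f/∂y`, `x` are the mesh
points and `N+1` is the number of mesh points.  Rows `0` and `N` come from the
boundary equations `Tu_0 = -u_0`, `Tu_N = -u_N`; interior rows are obtained by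
differentiating `Tu_i` with respect to `u_{i-1}, u_i, u_{i+1}`. -/
noncomputable def jacEntry (f' : ℝ → ℝ → ℝ) (γ β : ℝ) (x : ℕ → ℝ) (N : ℕ)
    (u : ℕ → ℝ) (i j : ℕ) : ℝ :=
  if i = 0 ∨ i = N then (if j = i then -1 else 0)
  else
    let h : ℕ → ℝ := fun k => x (k + 1) - x k
    let D : ℝ := Acoef β (h (i - 1)) + Acoef β (h i)
    if j + 1 = i then
      γ / D * (Bcoef β (h (i - 1)) - f' (x (i - 1)) (u (i - 1)) * Acoef β (h (i - 1)) / γ)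
    else if j = i then
      -(γ / D) * (Bcoef β (h (i - 1)) + Bcoef β (h i) + f' (x i) (u i) * D / γ)
    else if j = i + 1 then
      γ / D * (Bcoef β (h i) - f' (x (i + 1)) (u (i + 1)) * Acoef β (h i) / γ)
    else 0

lemma Acoef_pos {β h : ℝ} (hβ : 0 < β) (hh : 0 < h) : 0 < Acoef β h := by
  have hpos : 0 < β * h := mul_pos hβ hh
  exact div_pos (sub_pos.2 (Real.one_lt_cosh.2 hpos.ne')) (Real.sinh_pos_iff.2 hpos)

lemma Acoef_le_Bcoef {β h : ℝ} (hβ : 0 < β) (hh : 0 < h) : Acoef β h ≤ Bcoef β h :=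
  div_le_div_of_nonneg_right (by linarith) (Real.sinh_pos_iff.2 (mul_pos hβ hh)).le

/-- Scalar form of the dominance estimate: `p`, `q`, `r` are the values of the partial derivative
at the left, middle and right nodes of the stencil. -/
lemma two_mul_le_abs_stencil {γ m a b a' b' p q r : ℝ} (hm : 0 < m)
    (ha : 0 < a) (ha' : 0 < a') (hab : a ≤ b) (hab' : a' ≤ b')
    (hp : m ≤ p) (hq : m ≤ q) (hr : m ≤ r) (hpγ : p ≤ γ) (hrγ : r ≤ γ) :
    2 * m ≤ |-(γ / (a + a')) * (b + b' + q * (a + a') / γ)|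
      - |γ / (a + a') * (b - p * a / γ)| - |γ / (a + a') * (b' - r * a' / γ)| := by
  have hγ : 0 < γ := by linarith
  have hq0 : 0 < q := by linarith
  have hb : 0 < b := by linarith
  have hb' : 0 < b' := by linarith
  have hD : 0 < a + a' := by linarith
  have hoff : ∀ {s c d : ℝ}, 0 < c → c ≤ d → s ≤ γ → 0 ≤ γ / (a + a') * (d - s * c / γ) := by
    intro s c d hc hcd hs
    refine mul_nonneg (by positivity) (sub_nonneg.2 ?_)
    rw [div_le_iff₀ hγ]
    nlinarith
  rw [neg_mul, abs_neg, abs_of_nonneg (hoff ha hab hpγ), abs_of_nonneg (hoff ha' hab' hrγ),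
    abs_of_nonneg (by positivity)]
  have hsum : γ / (a + a') * (b + b' + q * (a + a') / γ) - γ / (a + a') * (b - p * a / γ)
      - γ / (a + a') * (b' - r * a' / γ) = q + (p * a + r * a') / (a + a') := by
    field_simp
    ring
  have hmean : m ≤ (p * a + r * a') / (a + a') := by
    rw [le_div_iff₀ hD]
    nlinarith
  linarith

/-- Strict diagonal dominance of the interior rows of the Jacobian of the discrete
operator `T`, with dominance at least `2m`:
`|h_{i,i}| − |h_{i,i−1}| − |h_{i,i+1}| ≥ 2m > 0`. -/
theorem jacobian_diagonally_dominant
    (ε m γ : ℝ) (N : ℕ) (f f' : ℝ → ℝ → ℝ) (x : ℕ → ℝ) (β : ℝ)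
    (hε : 0 < ε) (hε1 : ε < 1) (hm : 0 < m)
    (hβ : β = Real.sqrt γ / ε)
    (hf' : ∀ a u : ℝ, HasDerivAt (f a) (f' a u) u)
    (hfy : ∀ a ∈ Set.Icc (0:ℝ) 1, ∀ u : ℝ, m ≤ f' a u)
    (hγ : ∀ a ∈ Set.Icc (0:ℝ) 1, ∀ u : ℝ, f' a u ≤ γ)
    (hN : 2 ≤ N) (hx0 : x 0 = 0) (hxN : x N = 1)
    (hmesh : ∀ i : ℕ, i < N → x i < x (i + 1)) :
    ∀ u : ℕ → ℝ, ∀ i : ℕ, 1 ≤ i → i ≤ N - 1 →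
      2 * m ≤ |jacEntry f' γ β x N u i i| - |jacEntry f' γ β x N u i (i - 1)|
        - |jacEntry f' γ β x N u i (i + 1)| ∧ 0 < 2 * m := by
  intro u i hi hiN
  refine ⟨?_, by linarith⟩
  obtain ⟨k, rfl⟩ : ∃ k, i = k + 1 := ⟨i - 1, by omega⟩
  have hmono : ∀ a b : ℕ, a ≤ b → b ≤ N → x a ≤ x b := by
    intro a b hab
    induction b, hab using Nat.le_induction with
    | base => exact fun _ => le_rfl
    | succ n _ ih => exact fun hn => (ih (by omega)).trans (hmesh n (by omega)).le
  have hmem : ∀ j ≤ N, x j ∈ Set.Icc (0 : ℝ) 1 := fun j hj =>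
    ⟨hx0 ▸ hmono 0 j j.zero_le hj, hxN ▸ hmono j N hj le_rfl⟩
  have hγpos : 0 < γ := hm.trans_le ((hfy _ (hmem 0 N.zero_le) 0).trans (hγ _ (hmem 0 N.zero_le) 0))
  have hβpos : 0 < β := hβ ▸ div_pos (Real.sqrt_pos.2 hγpos) hε
  have hl : 0 < x (k + 1) - x k := sub_pos.2 (hmesh k (by omega))
  have hr : 0 < x (k + 1 + 1) - x (k + 1) := sub_pos.2 (hmesh (k + 1) (by omega))
  have hkN : ¬(k + 1 = 0 ∨ k + 1 = N) := by omega
  simp only [jacEntry, if_neg hkN, Nat.add_sub_cancel, if_true,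
    if_neg (show ¬(k + 1 + 1 = k + 1) by omega), if_neg (show ¬(k + 1 + 1 + 1 = k + 1) by omega)]
  exact two_mul_le_abs_stencil hm (Acoef_pos hβpos hl) (Acoef_pos hβpos hr)
    (Acoef_le_Bcoef hβpos hl) (Acoef_le_Bcoef hβpos hr)
    (hfy _ (hmem _ (by omega)) _) (hfy _ (hmem _ (by omega)) _) (hfy _ (hmem _ (by omega)) _)
    (hγ _ (hmem _ (by omega)) _) (hγ _ (hmem _ (by omega)) _)
end

section
/- There exist constants C₀, C > 0 independent of ε and N such that: if ε ≤ C₀ N^{−1} and λ = 2ε ln N/√m < 1/4, then for all i = N/4, …, N/2 − 1 (so that x_{i−1}, x_i, x_{i+1} ∈ [x_{N/4−1}, 1/2]), γ/(A(h_{i−1})+A(h_i)) · | (f(x_{i−1},y(x_{i−1})) + f(x_i,y(x_i)))A(h_{i−1})/γ + (f(x_i,y(x_i)) + f(x_{i+1},y(x_{i+1})))A(h_i)/γ | ≤ C N^{−2}, where y is the exact solution of the boundary value problem. -/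
open Set Filter Topology

section ReducedSolution

variable {f : ℝ → ℝ → ℝ} {s : Set ℝ} {m : ℝ}

theorem contDiff_section {n : WithTop ℕ∞}
    (hf : ContDiffOn ℝ n (Function.uncurry f) (s ×ˢ univ)) {a : ℝ} (ha : a ∈ s) :
    ContDiff ℝ n (f a) := by
  have h : ContDiffOn ℝ n (Function.uncurry f ∘ fun u : ℝ => (a, u)) univ :=
    hf.comp (contDiff_prodMk_right a).contDiffOn (fun u _ => ⟨ha, mem_univ _⟩)
  exact contDiffOn_univ.1 h

theorem exists_eq_zero_of_le_deriv {g : ℝ → ℝ} (hm : 0 < m) (hg : Differentiable ℝ g)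
    (hg' : ∀ u, m ≤ deriv g u) : ∃ u, g u = 0 := by
  have h1 : g (-(|g 0| / m)) ≤ 0 := by
    have h := mul_sub_le_image_sub_of_le_deriv hg hg'
      (show -(|g 0| / m) ≤ 0 from neg_nonpos.2 (by positivity))
    have h2 : m * (0 - -(|g 0| / m)) = |g 0| := by field_simp; ring
    linarith [le_abs_self (g 0)]
  have h2 : 0 ≤ g (|g 0| / m) := by
    have h := mul_sub_le_image_sub_of_le_deriv hg hg'
      (show 0 ≤ |g 0| / m by positivity)
    have h2 : m * (|g 0| / m - 0) = |g 0| := by field_simp; ring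
    linarith [neg_abs_le (g 0)]
  exact mem_range_of_exists_le_of_exists_ge hg.continuous ⟨_, h1⟩ ⟨_, h2⟩

theorem mul_abs_sub_le_of_le_deriv {g : ℝ → ℝ} (hg : Differentiable ℝ g)
    (hg' : ∀ u, m ≤ deriv g u) (u v : ℝ) : m * |u - v| ≤ |g u - g v| := by
  wlog h : v ≤ u generalizing u v
  · rw [abs_sub_comm, abs_sub_comm (g u)]
    exact this v u (le_of_not_ge h)
  rw [abs_of_nonneg (sub_nonneg.2 h)]
  exact (mul_sub_le_image_sub_of_le_deriv hg hg' h).trans (le_abs_self _)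

theorem continuousOn_of_apply_eq_zero (hm : 0 < m)
    (hf : ContDiffOn ℝ 2 (Function.uncurry f) (s ×ˢ univ))
    (hfy : ∀ a ∈ s, ∀ u, m ≤ deriv (f a) u) {v : ℝ → ℝ} (hv : ∀ a ∈ s, f a (v a) = 0) :
    ContinuousOn v s := by
  intro a ha
  have hc : ContinuousWithinAt (fun b => f b (v a)) s a := by
    have h : ContinuousOn (Function.uncurry f ∘ fun b : ℝ => (b, v a)) s :=
      hf.continuousOn.comp (by fun_prop) (fun b hb => ⟨hb, mem_univ _⟩)
    exact h a ha
  have hlim : Tendsto (fun b => |f b (v a)| / m) (𝓝[s] a) (𝓝 0) := by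
    have h := (hc.tendsto.abs).div_const m
    rwa [hv a ha, abs_zero, zero_div] at h
  refine tendsto_iff_norm_sub_tendsto_zero.2 (squeeze_zero' (.of_forall fun _ => norm_nonneg _)
    ?_ hlim)
  filter_upwards [self_mem_nhdsWithin] with b hb
  rw [Real.norm_eq_abs, le_div_iff₀' hm]
  have h := mul_abs_sub_le_of_le_deriv
    ((contDiff_section hf hb).differentiable (by norm_num)) (hfy b hb) (v b) (v a)
  rwa [hv b hb, zero_sub, abs_neg] at h

theorem deriv_section_eq
    (hf : ContDiffOn ℝ 2 (Function.uncurry f) (s ×ˢ univ)) {a : ℝ} (ha : a ∈ s) (u : ℝ) :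
    deriv (f a) u = fderivWithin ℝ (Function.uncurry f) (s ×ˢ univ) (a, u) (0, 1) := by
  have h := (hf.differentiableOn (by norm_num) (a, u) ⟨ha, mem_univ _⟩).hasFDerivWithinAt
  have h2 : HasDerivWithinAt (fun u : ℝ => (a, u)) ((0 : ℝ), (1 : ℝ)) univ u :=
    (hasDerivWithinAt_const _ _ _).prodMk (hasDerivWithinAt_id _ _)
  have h3 := h.comp_hasDerivWithinAt u h2 (fun u _ => ⟨ha, mem_univ _⟩)
  exact (hasDerivWithinAt_univ.1 h3).deriv

theorem hasDerivWithinAt_of_apply_eq_zero (hm : 0 < m)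
    (hf : ContDiffOn ℝ 2 (Function.uncurry f) (s ×ˢ univ))
    (hfy : ∀ a ∈ s, ∀ u, m ≤ deriv (f a) u) {v : ℝ → ℝ} (hv : ∀ a ∈ s, f a (v a) = 0)
    {a : ℝ} (ha : a ∈ s) :
    HasDerivWithinAt v
      (-(fderivWithin ℝ (Function.uncurry f) (s ×ˢ univ) (a, v a) (1, 0)) /
        fderivWithin ℝ (Function.uncurry f) (s ×ˢ univ) (a, v a) (0, 1)) s a := by
  have hF := (hf.differentiableOn (by norm_num) (a, v a) ⟨ha, mem_univ _⟩).hasFDerivWithinAt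
  have hpos : 0 < fderivWithin ℝ (Function.uncurry f) (s ×ˢ univ) (a, v a) (0, 1) := by
    rw [← deriv_section_eq hf ha]
    exact hm.trans_le (hfy a ha _)
  set L := fderivWithin ℝ (Function.uncurry f) (s ×ˢ univ) (a, v a) with hL
  have hsplit : ∀ p q : ℝ, L (p, q) = p * L (1, 0) + q * L (0, 1) := by
    intro p q
    have : ((p, q) : ℝ × ℝ) = p • (1, 0) + q • (0, 1) := by simp
    rw [this, map_add, map_smul, map_smul, smul_eq_mul, smul_eq_mul]
  have hcont := continuousOn_of_apply_eq_zero hm hf hfy hv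
  have hgraph : Tendsto (fun b => (b, v b)) (𝓝[s] a) (𝓝[s ×ˢ univ] (a, v a)) := by
    refine tendsto_nhdsWithin_iff.2 ⟨?_, ?_⟩
    · exact ((continuousOn_id.prodMk hcont) a ha).tendsto
    · filter_upwards [self_mem_nhdsWithin] with b hb using ⟨hb, mem_univ _⟩
  have hdiff := HasFDerivWithinAt.of_comp_of_leftInverse
    (f := fun p : ℝ × ℝ => (p.1, Function.uncurry f p)) (g := fun b => (b, v b))
    (h := fun b : ℝ => (b, (0 : ℝ)))
    (f'symm := (ContinuousLinearMap.fst ℝ ℝ ℝ).prod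
      ((L (0, 1))⁻¹ • (ContinuousLinearMap.snd ℝ ℝ ℝ -
        (L (1, 0)) • ContinuousLinearMap.fst ℝ ℝ ℝ)))
    hgraph (hasFDerivWithinAt_fst.prodMk hF)
    ((hasFDerivWithinAt_id a s).prodMk (hasFDerivWithinAt_const 0 a s))
    (by
      filter_upwards [self_mem_nhdsWithin] with b hb
      simp [hv b hb])
    (by
      rintro ⟨p, q⟩
      simp only [ContinuousLinearMap.prod_apply, ContinuousLinearMap.coe_fst',
        smul_apply, sub_apply,
        ContinuousLinearMap.coe_snd', hsplit p q, smul_eq_mul, Prod.mk.injEq, true_and]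
      field_simp
      ring)
    ha
  simpa [div_eq_inv_mul] using hdiff.snd.hasDerivWithinAt

theorem contDiffOn_of_apply_eq_zero (hs : UniqueDiffOn ℝ s) (hm : 0 < m)
    (hf : ContDiffOn ℝ 2 (Function.uncurry f) (s ×ˢ univ))
    (hfy : ∀ a ∈ s, ∀ u, m ≤ deriv (f a) u) {v : ℝ → ℝ} (hv : ∀ a ∈ s, f a (v a) = 0) :
    ContDiffOn ℝ 2 v s := by
  have hder := fun a ha => hasDerivWithinAt_of_apply_eq_zero hm hf hfy hv (a := a) ha
  have hL : ContDiffOn ℝ 1 (fderivWithin ℝ (Function.uncurry f) (s ×ˢ univ)) (s ×ˢ univ) :=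
    hf.fderivWithin (hs.prod uniqueDiffOn_univ) (by norm_num)
  have hstep : ∀ n : WithTop ℕ∞, n ≤ 1 → n ≠ ⊤ → ContDiffOn ℝ n v s →
      ContDiffOn ℝ (n + 1) v s := by
    intro n hn hn' hvn
    refine (contDiffOn_succ_iff_derivWithin hs).2
      ⟨fun a ha => (hder a ha).differentiableWithinAt, fun h => absurd h hn', ?_⟩
    have hc : ContDiffOn ℝ n
        (fun a => fderivWithin ℝ (Function.uncurry f) (s ×ˢ univ) (a, v a)) s :=
      (hL.of_le hn).comp (contDiffOn_id.prodMk hvn) (fun a ha => ⟨ha, mem_univ _⟩)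
    refine ContDiffOn.congr (((hc.clm_apply contDiffOn_const).neg).div
      (hc.clm_apply contDiffOn_const) ?_) (fun a ha => (hder a ha).derivWithin (hs a ha))
    intro a ha
    rw [← deriv_section_eq hf ha]
    exact (hm.trans_le (hfy a ha _)).ne'
  have h0 : ContDiffOn ℝ 0 v s :=
    contDiffOn_zero.2 (continuousOn_of_apply_eq_zero hm hf hfy hv)
  have h1 : ContDiffOn ℝ 1 v s := by simpa using hstep 0 (by norm_num) (by simp) h0
  have h2 := hstep 1 le_rfl (by simp) h1
  rwa [one_add_one_eq_two] at h2

end ReducedSolution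

theorem deriv_deriv_nonpos_of_isLocalMax {φ : ℝ → ℝ} {a : ℝ} (hmax : IsLocalMax φ a)
    (hc : ContinuousAt φ a) : deriv (deriv φ) a ≤ 0 := by
  by_contra! h
  have hmin := isLocalMin_of_deriv_deriv_pos h hmax.deriv_eq_zero hc
  have hconst : φ =ᶠ[𝓝 a] fun _ => φ a := by
    filter_upwards [hmax, hmin] with b h1 h2 using le_antisymm h1 h2
  have := hconst.deriv.deriv_eq
  simp at this
  linarith

/-- Supersolution for the operator sending v to ε² D²v - m v, with a layer at each end of [0, 1]. -/
noncomputable def layerBarrier (m ε K M : ℝ) (x : ℝ) : ℝ :=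
  K * ε ^ 2 / m + M * Real.exp (-(√m / ε * x)) + M * Real.exp (-(√m / ε * (1 - x)))

theorem contDiff_layerBarrier (m ε K M : ℝ) {n : WithTop ℕ∞} :
    ContDiff ℝ n (layerBarrier m ε K M) := by
  unfold layerBarrier
  fun_prop

theorem iteratedDeriv_two_layerBarrier {m ε : ℝ} (hm : 0 < m) (hε : 0 < ε) (K M x : ℝ) :
    ε ^ 2 * iteratedDeriv 2 (layerBarrier m ε K M) x
      = m * layerBarrier m ε K M x - K * ε ^ 2 := by
  set c := √m / ε with hcdef
  have e1 : ∀ x : ℝ, HasDerivAt (fun x => Real.exp (-(c * x))) (-c * Real.exp (-(c * x))) x := by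
    intro x
    convert (((hasDerivAt_id' x).const_mul c).fun_neg).exp using 1
    ring
  have e2 : ∀ x : ℝ, HasDerivAt (fun x => Real.exp (-(c * (1 - x))))
      (c * Real.exp (-(c * (1 - x)))) x := by
    intro x
    convert ((((hasDerivAt_id' x).const_sub 1).const_mul c).fun_neg).exp using 1
    ring
  have h1 : deriv (layerBarrier m ε K M) = fun x =>
      M * (-c * Real.exp (-(c * x))) + M * (c * Real.exp (-(c * (1 - x)))) := by
    funext x
    exact ((((e1 x).const_mul M).const_add (K * ε ^ 2 / m)).add ((e2 x).const_mul M)).deriv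
  have h2 : iteratedDeriv 2 (layerBarrier m ε K M) x =
      M * (-c * (-c * Real.exp (-(c * x)))) + M * (c * (c * Real.exp (-(c * (1 - x))))) := by
    rw [iteratedDeriv_succ, iteratedDeriv_one, h1]
    exact ((((e1 x).const_mul (-c)).const_mul M).add (((e2 x).const_mul c).const_mul M)).deriv
  have hc : ε ^ 2 * c ^ 2 = m := by
    rw [hcdef, div_pow, Real.sq_sqrt hm.le]
    field_simp
  have hK : m * (K * ε ^ 2 / m) = K * ε ^ 2 := by field_simp
  rw [h2, layerBarrier, ← hcdef]
  linear_combination -hK + (M * Real.exp (-(c * x)) + M * Real.exp (-(c * (1 - x)))) * hc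

theorem le_layerBarrier {m ε K M : ℝ} (hm : 0 < m) (hε : 0 < ε) (hK : 0 ≤ K) (hM : 0 ≤ M)
    {v : ℝ → ℝ} (hv : ContDiffOn ℝ 2 v (Icc 0 1)) (h0 : v 0 ≤ M) (h1 : v 1 ≤ M)
    (hode : ∀ a ∈ Ioo (0 : ℝ) 1, 0 < v a →
      m * v a - K * ε ^ 2 ≤ ε ^ 2 * iteratedDerivWithin 2 v (Icc 0 1) a)
    {x : ℝ} (hx : x ∈ Icc (0 : ℝ) 1) : v x ≤ layerBarrier m ε K M x := by
  have hcont : ContinuousOn (fun x => v x - layerBarrier m ε K M x) (Icc 0 1) :=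
    hv.continuousOn.sub (contDiff_layerBarrier m ε K M (n := 2)).continuous.continuousOn
  obtain ⟨a, ha, hamax⟩ := isCompact_Icc.exists_isMaxOn ⟨x, hx⟩ hcont
  suffices h : v a - layerBarrier m ε K M a ≤ 0 from sub_nonpos.1 ((hamax hx).trans h)
  have hKm : 0 ≤ K * ε ^ 2 / m := by positivity
  have hnonneg : ∀ y, 0 ≤ layerBarrier m ε K M y := fun y => by unfold layerBarrier; positivity
  by_contra! hlt
  have ha0 : a ≠ 0 := by
    rintro rfl
    have : M ≤ layerBarrier m ε K M 0 := by
      have : 0 ≤ M * Real.exp (-(√m / ε * (1 - 0))) := by positivity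
      simp only [layerBarrier, mul_zero, neg_zero, Real.exp_zero, mul_one]
      linarith
    linarith
  have ha1 : a ≠ 1 := by
    rintro rfl
    have : M ≤ layerBarrier m ε K M 1 := by
      have : 0 ≤ M * Real.exp (-(√m / ε * 1)) := by positivity
      simp only [layerBarrier, sub_self, mul_zero, neg_zero, Real.exp_zero, mul_one] at this ⊢
      linarith
    linarith
  have haI : a ∈ Ioo (0 : ℝ) 1 := ⟨lt_of_le_of_ne ha.1 ha0.symm, lt_of_le_of_ne ha.2 ha1⟩
  have hnhds : Icc (0 : ℝ) 1 ∈ 𝓝 a := Icc_mem_nhds haI.1 haI.2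
  have hva : ContDiffAt ℝ 2 v a := hv.contDiffAt hnhds
  have hba : ContDiffAt ℝ 2 (layerBarrier m ε K M) a := (contDiff_layerBarrier m ε K M).contDiffAt
  have hD := deriv_deriv_nonpos_of_isLocalMax (hamax.isLocalMax hnhds)
    (hva.continuousAt.sub hba.continuousAt)
  rw [show deriv (deriv fun x => v x - layerBarrier m ε K M x) a =
    iteratedDeriv 2 (fun x => v x - layerBarrier m ε K M x) a by
      rw [iteratedDeriv_succ, iteratedDeriv_one],
    iteratedDeriv_fun_sub (by exact_mod_cast hva) (by exact_mod_cast hba)] at hD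
  have hva' := hode a haI (by linarith [hnonneg a])
  rw [iteratedDerivWithin_eq_iteratedDeriv (uniqueDiffOn_Icc zero_lt_one) hva ha] at hva'
  have hb := iteratedDeriv_two_layerBarrier hm hε K M a
  have e : 0 < m * (v a - layerBarrier m ε K M a) := mul_pos hm hlt
  nlinarith [mul_nonneg (sq_nonneg ε) (sub_nonneg.2 (sub_nonpos.1 hD))]

theorem exists_abs_apply_le_layerBarrier {f : ℝ → ℝ → ℝ} {m γ : ℝ} (hm : 0 < m)
    (hf : ContDiffOn ℝ 2 (Function.uncurry f) (Icc 0 1 ×ˢ univ))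
    (hfy : ∀ a ∈ Icc (0 : ℝ) 1, ∀ u : ℝ, m ≤ deriv (f a) u)
    (hγ : ∀ a ∈ Icc (0 : ℝ) 1, ∀ u : ℝ, deriv (f a) u ≤ γ) :
    ∃ K ≥ (0 : ℝ), ∃ M ≥ (0 : ℝ), ∀ (ε : ℝ) (y : ℝ → ℝ), 0 < ε →
      ContDiffOn ℝ 2 y (Icc 0 1) → y 0 = 0 → y 1 = 0 →
      (∀ a ∈ Ioo (0 : ℝ) 1, ε ^ 2 * iteratedDerivWithin 2 y (Icc 0 1) a = f a (y a)) →
      ∀ x ∈ Icc (0 : ℝ) 1, |f x (y x)| ≤ γ * layerBarrier m ε K M x := by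
  have hs : UniqueDiffOn ℝ (Icc (0 : ℝ) 1) := uniqueDiffOn_Icc zero_lt_one
  have hdiff : ∀ a ∈ Icc (0 : ℝ) 1, Differentiable ℝ (f a) := fun a ha =>
    (contDiff_section hf ha).differentiable (by norm_num)
  have hex : ∀ a, ∃ u, a ∈ Icc (0 : ℝ) 1 → f a u = 0 := by
    intro a
    by_cases ha : a ∈ Icc (0 : ℝ) 1
    · obtain ⟨u, hu⟩ := exists_eq_zero_of_le_deriv hm (hdiff a ha) (hfy a ha)
      exact ⟨u, fun _ => hu⟩
    · exact ⟨0, fun h => absurd h ha⟩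
  choose v hv using hex
  have hvC : ContDiffOn ℝ 2 v (Icc 0 1) := contDiffOn_of_apply_eq_zero hs hm hf hfy hv
  obtain ⟨K, hK⟩ := isCompact_Icc.exists_bound_of_continuousOn
    (hvC.continuousOn_iteratedDerivWithin (m := 2) le_rfl hs)
  have hK0 : 0 ≤ K := (norm_nonneg _).trans (hK 0 (by simp))
  refine ⟨K, hK0, max |v 0| |v 1|, (abs_nonneg _).trans (le_max_left _ _), ?_⟩
  intro ε y hε hy hy0 hy1 hode x hx
  have hM : 0 ≤ max |v 0| |v 1| := (abs_nonneg _).trans (le_max_left _ _)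
  have hsub : ∀ {p q : ℝ → ℝ}, ContDiffOn ℝ 2 p (Icc 0 1) → ContDiffOn ℝ 2 q (Icc 0 1) →
      ∀ a ∈ Icc (0 : ℝ) 1, iteratedDerivWithin 2 (p - q) (Icc 0 1) a =
        iteratedDerivWithin 2 p (Icc 0 1) a - iteratedDerivWithin 2 q (Icc 0 1) a :=
    fun hp hq a ha => iteratedDerivWithin_sub ha hs (hp a ha) (hq a ha)
  have hup : y x - v x ≤ layerBarrier m ε K (max |v 0| |v 1|) x := by
    refine le_layerBarrier hm hε hK0 hM (v := y - v) (hy.sub hvC) ?_ ?_ ?_ hx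
    · simpa [hy0] using (neg_le_abs _).trans (le_max_left |v 0| |v 1|)
    · simpa [hy1] using (neg_le_abs _).trans (le_max_right |v 0| |v 1|)
    · intro a ha hpos
      have ha' := Ioo_subset_Icc_self ha
      rw [hsub hy hvC a ha', mul_sub, hode a ha]
      have h1 := mul_sub_le_image_sub_of_le_deriv (hdiff a ha') (hfy a ha')
        (sub_nonneg.1 hpos.le)
      rw [hv a ha'] at h1
      have h2 := (abs_le.1 (hK a ha')).2
      have h3 := mul_le_mul_of_nonneg_left h2 (sq_nonneg ε)
      simp only [Pi.sub_apply]
      linarith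
  have hlo : v x - y x ≤ layerBarrier m ε K (max |v 0| |v 1|) x := by
    refine le_layerBarrier hm hε hK0 hM (v := v - y) (hvC.sub hy) ?_ ?_ ?_ hx
    · simpa [hy0] using (le_abs_self _).trans (le_max_left |v 0| |v 1|)
    · simpa [hy1] using (le_abs_self _).trans (le_max_right |v 0| |v 1|)
    · intro a ha hpos
      have ha' := Ioo_subset_Icc_self ha
      rw [hsub hvC hy a ha', mul_sub, hode a ha]
      have h1 := mul_sub_le_image_sub_of_le_deriv (hdiff a ha') (hfy a ha')
        (sub_nonneg.1 hpos.le)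
      rw [hv a ha'] at h1
      have h2 := (abs_le.1 (hK a ha')).1
      have h3 := mul_le_mul_of_nonneg_left h2 (sq_nonneg ε)
      simp only [Pi.sub_apply]
      linarith
  have hγ0 : 0 ≤ γ := hm.le.trans ((hfy 0 (by simp) 0).trans (hγ 0 (by simp) 0))
  rcases le_total (v x) (y x) with h | h
  · have h1 := image_sub_le_mul_sub_of_deriv_le (hdiff x hx) (hγ x hx) h
    have h2 := mul_sub_le_image_sub_of_le_deriv (hdiff x hx) (hfy x hx) h
    have h3 := mul_nonneg hm.le (sub_nonneg.2 h)
    rw [hv x hx] at h1 h2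
    rw [abs_of_nonneg (by linarith)]
    linarith [mul_le_mul_of_nonneg_left hup hγ0]
  · have h1 := image_sub_le_mul_sub_of_deriv_le (hdiff x hx) (hγ x hx) h
    have h2 := mul_sub_le_image_sub_of_le_deriv (hdiff x hx) (hfy x hx) h
    have h3 := mul_nonneg hm.le (sub_nonneg.2 h)
    rw [hv x hx] at h1 h2
    rw [abs_of_nonpos (by linarith)]
    linarith [mul_le_mul_of_nonneg_left hlo hγ0]

theorem layerBarrier_le_of_le_half {m ε K M t x : ℝ} (hε : 0 < ε) (hM : 0 ≤ M) (htx : t ≤ x)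
    (hx : x ≤ 1 / 2) :
    layerBarrier m ε K M x ≤ K * ε ^ 2 / m + 2 * M * Real.exp (-(√m / ε * t)) := by
  have hc : 0 ≤ √m / ε := by positivity
  have h1 : Real.exp (-(√m / ε * x)) ≤ Real.exp (-(√m / ε * t)) := by gcongr
  have h2 : Real.exp (-(√m / ε * (1 - x))) ≤ Real.exp (-(√m / ε * t)) := by
    gcongr
    linarith
  unfold layerBarrier
  linarith [mul_le_mul_of_nonneg_left h1 hM, mul_le_mul_of_nonneg_left h2 hM]

theorem shishkinPsi_mono_of_le_half {lam s t : ℝ} (h0 : 0 ≤ lam) (h1 : lam ≤ 1 / 4)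
    (hst : s ≤ t) (ht : t ≤ 1 / 2) : shishkinPsi lam s ≤ shishkinPsi lam t := by
  have hl : 4 * lam * s ≤ 4 * lam * t := by gcongr
  have h4 : 0 ≤ 32 * (1 - 4 * lam) := by linarith
  unfold shishkinPsi
  rw [if_pos ht, if_pos (hst.trans ht)]
  split_ifs with hs4 ht4 ht4
  · exact hl
  · have : 0 ≤ 32 * (1 - 4 * lam) * (t - 1 / 4) ^ 3 :=
      mul_nonneg h4 (pow_nonneg (by linarith) 3)
    linarith
  · linarith
  · have : (s - 1 / 4) ^ 3 ≤ (t - 1 / 4) ^ 3 :=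
      pow_le_pow_left₀ (by linarith) (by linarith) 3
    linarith [mul_le_mul_of_nonneg_left this h4]

theorem shishkinPsi_half (lam : ℝ) : shishkinPsi lam (1 / 2) = 1 / 2 := by
  norm_num [shishkinPsi]
  ring

theorem shishkinPsi_of_le_quarter {lam t : ℝ} (ht : t ≤ 1 / 4) :
    shishkinPsi lam t = 4 * lam * t := by
  rw [shishkinPsi, if_pos (by linarith), if_pos ht]

theorem Acoef_nonneg {β h : ℝ} (hβ : 0 ≤ β) (hh : 0 ≤ h) : 0 ≤ Acoef β h :=
  div_nonneg (sub_nonneg.2 (Real.one_le_cosh _)) (Real.sinh_nonneg_iff.2 (mul_nonneg hβ hh))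

theorem div_mul_abs_weighted_le {γ A B p q D : ℝ} (hγ : 0 < γ) (hA : 0 ≤ A) (hB : 0 ≤ B)
    (hD : 0 ≤ D) (hp : |p| ≤ D) (hq : |q| ≤ D) :
    γ / (A + B) * |p * A / γ + q * B / γ| ≤ D := by
  rw [← add_div, abs_div, abs_of_pos hγ]
  rw [show γ / (A + B) * (|p * A + q * B| / γ) = |p * A + q * B| / (A + B) by field_simp]
  refine div_le_of_le_mul₀ (add_nonneg hA hB) hD ?_
  calc |p * A + q * B| ≤ |p| * A + |q| * B := by
        simpa [abs_mul, abs_of_nonneg hA, abs_of_nonneg hB] using abs_add_le (p * A) (q * B)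
    _ ≤ D * A + D * B := by gcongr
    _ = D * (A + B) := by ring

theorem exp_neg_transition_le {m ε N : ℝ} (hm : 0 < m) (hε : 0 < ε) (hN : 0 < N) :
    Real.exp (-(√m / ε * (4 * (2 * ε * Real.log N / √m) * (1 / 4 - 1 / N)))) ≤
      Real.exp 8 / N ^ 2 := by
  have hsm : 0 < √m := Real.sqrt_pos.2 hm
  have hlog : Real.log N / N ≤ 1 := by
    rw [div_le_one hN]
    linarith [Real.log_le_sub_one_of_pos hN]
  have e : -(√m / ε * (4 * (2 * ε * Real.log N / √m) * (1 / 4 - 1 / N))) =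
      8 * (Real.log N / N) - 2 * Real.log N := by
    field_simp
    ring
  have e2 : Real.exp (2 * Real.log N) = N ^ 2 := by
    rw [two_mul, Real.exp_add, Real.exp_log hN, sq]
  rw [e, Real.exp_sub, e2]
  gcongr
  linarith

/-- Lemma 1: on the part `[x_{N/4-1}, 1/2]` of the modified Shishkin mesh, assuming
`ε ≤ C₀/N` and `λ = 2ε ln N/√m < 1/4`, the weighted combination of the values of `f`
at the exact solution is bounded by `C/N²`. -/
theorem lemma1_f_term_bound
    (m γ : ℝ) (k : ℕ) (f : ℝ → ℝ → ℝ)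
    (hm : 0 < m) (hk : 2 ≤ k)
    (hf : ContDiffOn ℝ k (Function.uncurry f) (Set.Icc 0 1 ×ˢ Set.univ))
    (hfy : ∀ a ∈ Set.Icc (0:ℝ) 1, ∀ u : ℝ, m ≤ deriv (f a) u)
    (hγ : ∀ a ∈ Set.Icc (0:ℝ) 1, ∀ u : ℝ, deriv (f a) u ≤ γ) :
    ∃ C₀ > (0:ℝ), ∃ C > (0:ℝ), ∀ (ε : ℝ) (N : ℕ) (y : ℝ → ℝ),
      0 < ε → ε < 1 → 0 < N → 4 ∣ N → ε ≤ C₀ / N →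
      ContDiffOn ℝ 2 y (Set.Icc 0 1) → y 0 = 0 → y 1 = 0 →
      (∀ a ∈ Set.Ioo (0:ℝ) 1,
        ε ^ 2 * iteratedDerivWithin 2 y (Set.Icc 0 1) a = f a (y a)) →
      2 * ε * Real.log N / Real.sqrt m < 1 / 4 →
      let lam : ℝ := 2 * ε * Real.log N / Real.sqrt m
      let β : ℝ := Real.sqrt γ / ε
      let x : ℕ → ℝ := fun i => shishkinPsi lam ((i : ℝ) / (N : ℝ))
      let h : ℕ → ℝ := fun i => x (i + 1) - x i
      ∀ i : ℕ, N / 4 ≤ i → i ≤ N / 2 - 1 →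
        γ / (Acoef β (h (i - 1)) + Acoef β (h i)) *
          |(f (x (i - 1)) (y (x (i - 1))) + f (x i) (y (x i))) * Acoef β (h (i - 1)) / γ +
           (f (x i) (y (x i)) + f (x (i + 1)) (y (x (i + 1)))) * Acoef β (h i) / γ| ≤
        C / (N : ℝ) ^ 2 := by
  have hf2 : ContDiffOn ℝ 2 (Function.uncurry f) (Icc 0 1 ×ˢ univ) :=
    hf.of_le (by exact_mod_cast hk)
  have hγ0 : 0 < γ := hm.trans_le ((hfy 0 (by simp) 0).trans (hγ 0 (by simp) 0))
  obtain ⟨K, hK, M, hM, hbound⟩ := exists_abs_apply_le_layerBarrier hm hf2 hfy hγ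
  refine ⟨1, one_pos, 2 * (γ * (K / m + 2 * M * Real.exp 8)) + 1, by positivity, ?_⟩
  intro ε N y hε _ hN hdvd hεN hy hy0 hy1 hode hlam lam β x h i hi1 hi2
  obtain ⟨n, rfl⟩ := hdvd
  have hn : 1 ≤ n := by omega
  have hi1' : n ≤ i := by omega
  have hi2' : i + 1 ≤ 2 * n := by omega
  have hNr : (0 : ℝ) < ((4 * n : ℕ) : ℝ) := by exact_mod_cast hN
  have hlam0 : 0 ≤ lam := by
    have := Real.log_natCast_nonneg (4 * n)
    positivity
  have hmono : ∀ j l : ℕ, j ≤ l → l ≤ 2 * n → x j ≤ x l := by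
    intro j l hjl hl
    refine shishkinPsi_mono_of_le_half hlam0 hlam.le (by gcongr) ?_
    rw [div_le_iff₀ hNr]
    have : (l : ℝ) ≤ 2 * n := by exact_mod_cast hl
    push_cast
    linarith
  have hpoint : ∀ j : ℕ, n - 1 ≤ j → j ≤ 2 * n →
      |f (x j) (y (x j))| ≤ γ * (K / m + 2 * M * Real.exp 8) / ((4 * n : ℕ) : ℝ) ^ 2 := by
    intro j hj1 hj2
    have hlow : 4 * lam * (1 / 4 - 1 / ((4 * n : ℕ) : ℝ)) ≤ x j := by
      refine le_trans (le_of_eq ?_) (hmono (n - 1) j hj1 hj2)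
      have e : ((n - 1 : ℕ) : ℝ) / ((4 * n : ℕ) : ℝ) = 1 / 4 - 1 / ((4 * n : ℕ) : ℝ) := by
        rw [Nat.cast_sub hn]
        push_cast at hNr ⊢
        field_simp
      rw [← e]
      refine (shishkinPsi_of_le_quarter ?_).symm
      rw [e]
      have : 0 ≤ 1 / ((4 * n : ℕ) : ℝ) := by positivity
      linarith
    have hhigh : x j ≤ 1 / 2 := by
      refine (hmono j (2 * n) hj2 le_rfl).trans (le_of_eq ?_)
      have e : ((2 * n : ℕ) : ℝ) / ((4 * n : ℕ) : ℝ) = 1 / 2 := by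
        push_cast at hNr ⊢
        field_simp
        norm_num
      simp only [x, e, shishkinPsi_half]
    have hx0 : 0 ≤ x j := by
      refine le_trans (le_of_eq ?_) (hmono 0 j (Nat.zero_le _) hj2)
      simp [x, shishkinPsi]
    have hfb := hbound ε y hε hy hy0 hy1 hode (x j) ⟨hx0, by linarith⟩
    have hW := layerBarrier_le_of_le_half (m := m) (K := K) hε hM hlow hhigh
    have hexp := exp_neg_transition_le hm hε hNr
    have hε2 : ε ^ 2 ≤ 1 / ((4 * n : ℕ) : ℝ) ^ 2 := by
      rw [← one_div_pow]
      exact pow_le_pow_left₀ hε.le hεN 2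
    calc |f (x j) (y (x j))| ≤ γ * layerBarrier m ε K M (x j) := hfb
      _ ≤ γ * (K * (1 / ((4 * n : ℕ) : ℝ) ^ 2) / m +
            2 * M * (Real.exp 8 / ((4 * n : ℕ) : ℝ) ^ 2)) := by
          refine mul_le_mul_of_nonneg_left (hW.trans ?_) hγ0.le
          gcongr
      _ = _ := by ring
  have hpair : ∀ j : ℕ, n - 1 ≤ j → j + 1 ≤ 2 * n →
      |f (x j) (y (x j)) + f (x (j + 1)) (y (x (j + 1)))| ≤
        (2 * (γ * (K / m + 2 * M * Real.exp 8)) + 1) / ((4 * n : ℕ) : ℝ) ^ 2 := by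
    intro j hj1 hj2
    have h1 := hpoint j hj1 (by omega)
    have h2 := hpoint (j + 1) (by omega) hj2
    have h3 : 0 ≤ 1 / ((4 * n : ℕ) : ℝ) ^ 2 := by positivity
    rw [add_div, mul_div_assoc]
    linarith [abs_add_le (f (x j) (y (x j))) (f (x (j + 1)) (y (x (j + 1))))]
  have hβ : 0 ≤ β := by positivity
  have hi : i - 1 + 1 = i := by omega
  have hp1 := hpair (i - 1) (by omega) (by omega)
  rw [hi] at hp1
  exact div_mul_abs_weighted_le hγ0
    (Acoef_nonneg hβ (sub_nonneg.2 (hmono _ _ (by omega) (by omega))))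
    (Acoef_nonneg hβ (sub_nonneg.2 (hmono _ _ (by omega) hi2')))
    (by positivity) hp1 (hpair i (by omega) hi2')
end
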